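/- arXiv:1304.4104 — 2 statements merged into one kernel-verified Lean document; each statement's English description precedes it below -/
import Mathlib

section
/- Let A = (Q_A, Σ, δ_A, q_A) and B = (Q_B, Σ, δ_B, q_B) be weighted finite automata whose rewards all lie in {0,1}, and let d ∉ Σ. Define the one-counter net A′ over Act = Σ ∪ {d} with control states Q_A ∪ {D_A} (D_A fresh) and transitions {(p, a, v, p′) | (p,a,v,p′) ∈ δ_A} ∪ {(D_A, d, −1, D_A)} ∪ {(q, d, −1, D_A) | q ∈ Q_A}; define B′ analogously from B with fresh state D_B. Then L(A) ⊆ L(B) if and only if T(q_A 0) ⊆ T(q_B 0), where the trace sets are taken in the LTSs induced by A′ and B′ respectively. -/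
/-- A one-counter net: control states `Q`, actions `A`, and
transitions `δ ⊆ Q × Act × {−1,0,1} × Q`. -/
structure OCN (Q A : Type) where
  δ : Q → A → ℤ → Q → Prop
  d_mem : ∀ p a d q, δ p a d q → d = -1 ∨ d = 0 ∨ d = 1

/-- The LTS induced by a one-counter net on configurations `Q × ℕ`:
`pm −a→ p′m′` iff `(p,a,d,p′) ∈ δ` and `m′ = m + d ≥ 0`. -/
def OCN.Step {Q A : Type} (N : OCN Q A) (c : Q × ℕ) (a : A) (c' : Q × ℕ) : Prop :=
  ∃ d : ℤ, N.δ c.1 a d c'.1 ∧ (c'.2 : ℤ) = (c.2 : ℤ) + d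
/-- Paths in an LTS labeled by words: `PathWord step c w c'` holds iff there is a
path from `c` to `c'` whose sequence of action labels is `w`. -/
inductive PathWord {C A : Type} (step : C → A → C → Prop) : C → List A → C → Prop
  | nil (c : C) : PathWord step c [] c
  | cons {c : C} {a : A} {c' : C} {w : List A} {c'' : C} :
      step c a c' → PathWord step c' w c'' → PathWord step c (a :: w) c''

/-- The trace set `T(s) = {w ∈ Act* | ∃ path from s labeled w}` of a state. -/
def Traces {C A : Type} (step : C → A → C → Prop) (c : C) : Set (List A) :=
  {w | ∃ c', PathWord step c w c'}

/-- A weighted finite automaton `(Q, Σ, δ, q₀)` with `δ ⊆ Q × Σ × ℕ × Q`. -/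
structure WFA (Q S : Type) where
  δ : Q → S → ℕ → Q → Prop
  q0 : Q

/-- `WFA.Run A q w v q'` : a run of `A` from `q` to `q'` on the word `w` of value `v`. -/
inductive WFA.Run {Q S : Type} (A : WFA Q S) : Q → List S → ℕ → Q → Prop
  | nil (q : Q) : WFA.Run A q [] 0 q
  | cons {q : Q} {a : S} {d : ℕ} {q' : Q} {w : List S} {v : ℕ} {q'' : Q} :
      A.δ q a d q' → WFA.Run A q' w v q'' → WFA.Run A q (a :: w) (d + v) q''

/-- `L(A) ⊆ L(B)` : for every word `w`, `L(A,w) ≤ L(B,w)`, i.e. every run of `A`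
on `w` is matched by a run of `B` on `w` of at least its value. -/
def WFA.LangLE {QA QB S : Type} (A : WFA QA S) (B : WFA QB S) : Prop :=
  ∀ (w : List S) (v : ℕ), (∃ q', A.Run A.q0 w v q') →
    ∃ v' ≥ v, ∃ q'', B.Run B.q0 w v' q''

/-- The one-counter net `A′` built from a WFA `A` with rewards in `{0,1}`:
control states `Q ∪ {D}` (the fresh state `D` is `Sum.inr ()`), actions
`Σ ∪ {d}` (the fresh action `d` is `Sum.inr ()`), and transitions
`{(p, a, v, p′) | (p,a,v,p′) ∈ δ} ∪ {(D, d, −1, D)} ∪ {(q, d, −1, D) | q ∈ Q}`. -/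
def WFAtoOCN {Q S : Type} (A : WFA Q S) (h : ∀ q a v q', A.δ q a v q' → v ≤ 1) :
    OCN (Q ⊕ Unit) (S ⊕ Unit) where
  δ := fun s act d t =>
    (∃ p a v p', A.δ p a v p' ∧ s = .inl p ∧ act = .inl a ∧ d = (v : ℤ) ∧ t = .inl p') ∨
    (s = .inr () ∧ act = .inr () ∧ d = -1 ∧ t = .inr ()) ∨
    (∃ q : Q, s = .inl q ∧ act = .inr () ∧ d = -1 ∧ t = .inr ())
  d_mem := by
    rintro p a d q (⟨p', a', v, p'', hδ, _, _, rfl, _⟩ | ⟨_, _, rfl, _⟩ | ⟨_, _, _, rfl, _⟩)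
    · have := h _ _ _ _ hδ; omega
    · tauto
    · tauto

theorem trace_dead_iff {Q S : Type} (A : WFA Q S) (h : ∀ q a v q', A.δ q a v q' → v ≤ 1)
    (u : List (S ⊕ Unit)) : ∀ m : ℕ,
    u ∈ Traces (WFAtoOCN A h).Step (Sum.inr (), m) ↔
      ∃ k ≤ m, u = List.replicate k (Sum.inr ()) := by
  induction u with
  | nil =>
    intro m
    exact ⟨fun _ => ⟨0, by omega, rfl⟩, fun _ => ⟨_, PathWord.nil _⟩⟩
  | cons x u ih =>
    intro m
    constructor
    · rintro ⟨c, hc⟩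
      cases hc with
      | @cons _ _ c' _ _ hs hp =>
        obtain ⟨s, n⟩ := c'
        obtain ⟨d, hd, hn⟩ := hs
        rcases hd with ⟨p, a, v, p', h1, h2, h3, h4, h5⟩ | ⟨h2, h3, h4, h5⟩ | ⟨q, h2, h3, h4, h5⟩
        · simp at h2
        · simp only at h5 hn
          subst h5 h3
          obtain ⟨k, hk, rfl⟩ := (ih n).1 ⟨c, hp⟩
          exact ⟨k + 1, by omega, rfl⟩
        · simp at h2
    · rintro ⟨k, hk, hu⟩
      cases k with
      | zero => simp at hu
      | succ k =>
        rw [List.replicate_succ, List.cons.injEq] at hu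
        obtain ⟨rfl, hu⟩ := hu
        obtain ⟨c, hc⟩ := (ih (m - 1)).2 ⟨k, by omega, hu⟩
        refine ⟨c, PathWord.cons ⟨-1, Or.inr (Or.inl ⟨rfl, rfl, rfl, rfl⟩), ?_⟩ hc⟩
        simp only
        omega

theorem trace_live_iff {Q S : Type} (A : WFA Q S) (h : ∀ q a v q', A.δ q a v q' → v ≤ 1)
    (u : List (S ⊕ Unit)) : ∀ (q : Q) (m : ℕ),
    u ∈ Traces (WFAtoOCN A h).Step (Sum.inl q, m) ↔
      ∃ w v k, (∃ q', A.Run q w v q') ∧ k ≤ m + v ∧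
        u = w.map Sum.inl ++ List.replicate k (Sum.inr ()) := by
  induction u with
  | nil =>
    intro q m
    exact ⟨fun _ => ⟨[], 0, 0, ⟨q, .nil q⟩, by omega, rfl⟩, fun _ => ⟨_, PathWord.nil _⟩⟩
  | cons x u ih =>
    intro q m
    constructor
    · rintro ⟨c, hc⟩
      cases hc with
      | @cons _ _ c' _ _ hs hp =>
        obtain ⟨s, n⟩ := c'
        obtain ⟨d, hd, hn⟩ := hs
        rcases hd with ⟨p, a, v, p', h1, h2, h3, h4, h5⟩ | ⟨h2, h3, h4, h5⟩ | ⟨q, h2, h3, h4, h5⟩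
        · simp only [Sum.inl.injEq] at h2 h5 hn
          subst h2 h5 h3
          obtain ⟨w, v', k, ⟨q', hr⟩, hk, rfl⟩ := (ih p' n).1 ⟨c, hp⟩
          exact ⟨a :: w, v + v', k, ⟨q', .cons h1 hr⟩, by omega, rfl⟩
        · simp at h2
        · simp only at h5 hn
          subst h5 h3
          obtain ⟨k, hk, rfl⟩ := (trace_dead_iff A h u n).1 ⟨c, hp⟩
          exact ⟨[], 0, k + 1, ⟨_, .nil _⟩, by omega, rfl⟩
    · rintro ⟨w, v, k, ⟨q', hr⟩, hk, hu⟩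
      cases hr with
      | nil =>
        cases k with
        | zero => simp at hu
        | succ k =>
          rw [List.map_nil, List.nil_append, List.replicate_succ, List.cons.injEq] at hu
          obtain ⟨rfl, hu⟩ := hu
          obtain ⟨c, hc⟩ := (trace_dead_iff A h u (m - 1)).2 ⟨k, by omega, hu⟩
          refine ⟨c, PathWord.cons ⟨-1, Or.inr (Or.inr ⟨q, rfl, rfl, rfl, rfl⟩), ?_⟩ hc⟩
          simp only
          omega
      | @cons _ a d p w v _ hd hr =>
        rw [List.map_cons, List.cons_append, List.cons.injEq] at hu
        obtain ⟨rfl, hu⟩ := hu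
        obtain ⟨c, hc⟩ := (ih p (m + d)).2 ⟨w, v, k, ⟨q', hr⟩, by omega, hu⟩
        refine ⟨c, PathWord.cons ⟨d, Or.inl ⟨q, a, d, p, hd, rfl, rfl, rfl, rfl⟩, ?_⟩ hc⟩
        simp only
        omega

theorem split_inj {S : Type} (w : List S) : ∀ (w' : List S) (k k' : ℕ),
    w.map Sum.inl ++ List.replicate k (Sum.inr ()) =
      w'.map Sum.inl ++ List.replicate k' (Sum.inr () : S ⊕ Unit) → w = w' ∧ k = k' := by
  induction w with
  | nil =>
    intro w' k k' e
    cases w' with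
    | nil => simpa using congrArg List.length e
    | cons a w' => cases k <;> simp [List.replicate_succ] at e
  | cons b w ih =>
    intro w' k k' e
    cases w' with
    | nil => cases k' <;> simp [List.replicate_succ] at e
    | cons a w' =>
      simp only [List.map_cons, List.cons_append, List.cons.injEq, Sum.inl.injEq] at e
      obtain ⟨rfl, e⟩ := e
      obtain ⟨rfl, rfl⟩ := ih _ _ _ e
      exact ⟨rfl, rfl⟩

/-- For WFAs `A` and `B` with rewards in `{0,1}` over the same alphabet:
`L(A) ⊆ L(B)` iff `T(q_A 0) ⊆ T(q_B 0)`, where the trace sets are taken in the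
LTSs induced by the one-counter nets `A′` and `B′`. -/
theorem wfa_containment_iff_trace_inclusion {QA QB S : Type} [Fintype QA]
    [Fintype QB] [Fintype S] (A : WFA QA S) (B : WFA QB S)
    (hA : ∀ q a v q', A.δ q a v q' → v ≤ 1)
    (hB : ∀ q a v q', B.δ q a v q' → v ≤ 1) :
    WFA.LangLE A B ↔
      Traces (WFAtoOCN A hA).Step (Sum.inl A.q0, 0) ⊆
        Traces (WFAtoOCN B hB).Step (Sum.inl B.q0, 0) := by
  constructor
  · intro hL u hu
    obtain ⟨w, v, k, hr, hk, rfl⟩ := (trace_live_iff A hA u _ _).1 hu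
    obtain ⟨v', hv, hr'⟩ := hL w v hr
    exact (trace_live_iff B hB _ _ _).2 ⟨w, v', k, hr', by omega, rfl⟩
  · intro hT w v hr
    obtain ⟨w', v', k, hr', hk, e⟩ := (trace_live_iff B hB _ _ _).1
      (hT ((trace_live_iff A hA _ _ _).2 ⟨w, v, v, hr, by omega, rfl⟩))
    obtain ⟨rfl, rfl⟩ := split_inj _ _ _ _ e
    exact ⟨v', by omega, hr'⟩
end

section
/- Let A = (Q, Act, δ, δ₀) be a one-counter automaton with K = |Q|, let p, q ∈ Q and m ∈ ℕ. If pm →* qn for some n ∈ ℕ, then there exist n′ ∈ ℕ and k ∈ ℕ with k ≤ max{m,1}·5K⁴ such that pm →^k qn′. -/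
/-- A one-counter automaton `(Q, Act, δ, δ₀)` with `δ ⊆ Q × Act × {−1,0,1} × Q`
and zero-test transitions `δ₀ ⊆ Q × Act × {0,1} × Q`. -/
structure OCA (Q A : Type) where
  δ : Q → A → ℤ → Q → Prop
  δ0 : Q → A → ℤ → Q → Prop
  d_mem : ∀ p a d q, δ p a d q → d = -1 ∨ d = 0 ∨ d = 1
  d0_mem : ∀ p a d q, δ0 p a d q → d = 0 ∨ d = 1

/-- The LTS induced by a one-counter automaton on configurations `Q × ℕ`:
`pm −a→ p′m′` iff either `(p,a,d,p′) ∈ δ` and `m′ = m + d ≥ 0`, or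
`(p,a,d,p′) ∈ δ₀`, `m = 0` and `m′ = d`. -/
def OCA.Step {Q A : Type} (M : OCA Q A) (c : Q × ℕ) (a : A) (c' : Q × ℕ) : Prop :=
  (∃ d : ℤ, M.δ c.1 a d c'.1 ∧ (c'.2 : ℤ) = (c.2 : ℤ) + d) ∨
  (∃ d : ℤ, M.δ0 c.1 a d c'.1 ∧ c.2 = 0 ∧ (c'.2 : ℤ) = d)

/-- `pm → qn` : a step under some action label. -/
def OCA.StepAny {Q A : Type} (M : OCA Q A) (c c' : Q × ℕ) : Prop :=
  ∃ a : A, M.Step c a c'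

/-- `Iter r k c c'` : a path of exactly `k` steps of `r` from `c` to `c'`. -/
inductive Iter {C : Type} (r : C → C → Prop) : ℕ → C → C → Prop
  | zero (c : C) : Iter r 0 c c
  | succ {c c' c'' : C} {k : ℕ} : r c c' → Iter r k c' c'' → Iter r (k + 1) c c''


theorem Iter.trans' {C : Type} {r : C → C → Prop} {k l : ℕ} {x y z : C}
    (h : Iter r k x y) (h' : Iter r l y z) : Iter r (k + l) x z := by
  induction h with
  | zero c => simpa using h'
  | succ hr _ ih =>
    have := Iter.succ hr (ih h')
    rwa [Nat.add_right_comm] at this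

theorem Iter.of_reflTransGen {C : Type} {r : C → C → Prop} {x y : C}
    (h : Relation.ReflTransGen r x y) : ∃ k, Iter r k x y := by
  induction h with
  | refl => exact ⟨0, Iter.zero _⟩
  | tail _ hr ih =>
    obtain ⟨k, hk⟩ := ih
    exact ⟨k + 1, hk.trans' (Iter.succ hr (Iter.zero _))⟩

theorem Iter.exists_fun {C : Type} {r : C → C → Prop} {k : ℕ} {x y : C}
    (h : Iter r k x y) : ∃ f : ℕ → C, f 0 = x ∧ f k = y ∧ ∀ s < k, r (f s) (f (s + 1)) := by
  induction h with
  | zero c => exact ⟨fun _ => c, rfl, rfl, by simp⟩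
  | @succ c c' c'' k hr _ ih =>
    obtain ⟨f, h0, hk, hs⟩ := ih
    refine ⟨fun n => Nat.casesOn n c f, rfl, hk, ?_⟩
    intro s hs'
    cases s with
    | zero => simpa [h0] using hr
    | succ s => exact hs s (by omega)

theorem Iter.of_fun {C : Type} {r : C → C → Prop} (f : ℕ → C) (i n : ℕ)
    (h : ∀ s, i ≤ s → s < i + n → r (f s) (f (s + 1))) : Iter r n (f i) (f (i + n)) := by
  induction n with
  | zero => exact Iter.zero _
  | succ n ih =>
    exact (ih fun s h1 h2 => h s h1 (by omega)).trans'
      (Iter.succ (h (i + n) (by omega) (by omega)) (Iter.zero _))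

theorem Iter.of_fun' {C : Type} {r : C → C → Prop} (f : ℕ → C) (i j : ℕ) (hij : i ≤ j)
    (h : ∀ s, i ≤ s → s < j → r (f s) (f (s + 1))) : Iter r (j - i) (f i) (f j) := by
  have := Iter.of_fun (r := r) f i (j - i) (fun s h1 h2 => h s h1 (by omega))
  rwa [show i + (j - i) = j by omega] at this

theorem OCA.StepAny.bound {Q A : Type} {M : OCA Q A} {c c' : Q × ℕ} (h : M.StepAny c c') :
    c'.2 ≤ c.2 + 1 ∧ c.2 ≤ c'.2 + 1 := by
  obtain ⟨a, ⟨d, hd, he⟩ | ⟨d, hd, h0, he⟩⟩ := h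
  · have := M.d_mem _ _ _ _ hd
    omega
  · have := M.d0_mem _ _ _ _ hd
    omega

theorem OCA.StepAny.shift {Q A : Type} {M : OCA Q A} {c c' : Q × ℕ} (h : M.StepAny c c')
    (d : ℕ) (hd : 0 < d) (h1 : d ≤ c.2) (h2 : d ≤ c'.2) :
    M.StepAny (c.1, c.2 - d) (c'.1, c'.2 - d) := by
  obtain ⟨a, ⟨e, he, heq⟩ | ⟨e, he, h0, heq⟩⟩ := h
  · refine ⟨a, Or.inl ⟨e, he, ?_⟩⟩
    simp only
    omega
  · omega

/-- A shortest path stays below `m + K(K+1)`. -/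
theorem oca_height {Q A : Type} [Fintype Q] (M : OCA Q A) (q : Q) (L : ℕ) (c : ℕ → Q × ℕ)
    (hq : (c L).1 = q) (hs : ∀ s < L, M.StepAny (c s) (c (s + 1)))
    (hmin : ∀ k n, Iter M.StepAny k (c 0) (q, n) → L ≤ k) (t : ℕ) (ht : t ≤ L) :
    (c t).2 ≤ (c 0).2 + Fintype.card Q * (Fintype.card Q + 1) := by
  by_contra! hlt
  set N := Fintype.card Q * (Fintype.card Q + 1) with hN
  have key : ∀ l : Fin (N + 1), ∃ (a : ℕ) (w : Option Q), a ≤ t ∧ (c a).2 = (c 0).2 + l ∧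
      (∀ s, a < s → s ≤ t → (c 0).2 + l < (c s).2) ∧
      ((w = none ∧ ∀ s, t ≤ s → s ≤ L → (c 0).2 + l < (c s).2) ∨
       (∃ b, t ≤ b ∧ b ≤ L ∧ w = some (c b).1 ∧ (c b).2 = (c 0).2 + l ∧
          ∀ s, t ≤ s → s < b → (c 0).2 + l < (c s).2)) := by
    intro l
    have hl := l.2
    set v := (c 0).2 + (l : ℕ) with hv
    have hvt : v < (c t).2 := by omega
    have hP0 : (c 0).2 ≤ v := by omega
    let a := Nat.findGreatest (fun s => (c s).2 ≤ v) t
    have ha1 : a ≤ t := Nat.findGreatest_le t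
    have ha2 : (c a).2 ≤ v := Nat.findGreatest_spec (P := fun s => (c s).2 ≤ v) (Nat.zero_le t) hP0
    have ha3 : ∀ s, a < s → s ≤ t → v < (c s).2 := fun s h1 h2 =>
      not_le.1 (Nat.findGreatest_is_greatest (P := fun s => (c s).2 ≤ v) h1 h2)
    have hat : a < t := lt_of_le_of_ne ha1 (fun h => by rw [h] at ha2; omega)
    have ha4 : (c a).2 = v := by
      have h1 := ha3 (a + 1) (by omega) (by omega)
      have h2 := (hs a (by omega)).bound
      omega
    by_cases hb : ∃ b, t ≤ b ∧ b ≤ L ∧ (c b).2 ≤ v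
    · classical
      obtain ⟨b1, b2, b3⟩ := Nat.find_spec hb
      have b4 : ∀ s, t ≤ s → s < Nat.find hb → v < (c s).2 := by
        intro s h1 h2
        by_contra! h3
        exact Nat.find_min hb h2 ⟨h1, by omega, h3⟩
      generalize Nat.find hb = b at *
      refine ⟨a, some (c b).1, ha1, ha4, ha3, Or.inr ⟨b, b1, b2, rfl, ?_, b4⟩⟩
      have hbt : t < b := lt_of_le_of_ne b1 (fun h => by rw [← h] at b3; omega)
      have h1 := b4 (b - 1) (by omega) (by omega)
      have h2 := (hs (b - 1) (by omega)).bound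
      rw [show b - 1 + 1 = b by omega] at h2
      omega
    · push Not at hb
      exact ⟨a, none, ha1, ha4, ha3, Or.inl ⟨rfl, fun s h1 h2 => hb s h1 h2⟩⟩
  choose a w hat hav hgt hw using key
  have hpig : ∃ i j : Fin (N + 1), i ≠ j ∧ ((c (a i)).1, w i) = ((c (a j)).1, w j) := by
    apply Fintype.exists_ne_map_eq_of_card_lt (fun i : Fin (N + 1) => ((c (a i)).1, w i))
    simp [Fintype.card_prod, hN]
  have hpig' : ∃ i j : Fin (N + 1), i < j ∧ ((c (a i)).1, w i) = ((c (a j)).1, w j) := by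
    obtain ⟨i, j, hne, he⟩ := hpig
    rcases lt_or_gt_of_ne hne with h | h
    · exact ⟨i, j, h, he⟩
    · exact ⟨j, i, h, he.symm⟩
  obtain ⟨i, j, hij, he⟩ := hpig'
  obtain ⟨he1, he2⟩ := Prod.mk.inj he
  have hij' : (i : ℕ) < j := hij
  have haij : a i < a j := by
    by_contra! h
    rcases h.lt_or_eq with h | h
    · have := hgt j (a i) h (hat i)
      have := hav i
      omega
    · have h1 := hav i
      have h2 := hav j
      rw [h] at h2
      omega
  have hi := hat i
  have hj := hat j
  have hvi := hav i
  have hvj := hav j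
  have hgj := hgt j
  have I1 : Iter M.StepAny (a i) (c 0) (c (a i)) := by
    have := Iter.of_fun' (r := M.StepAny) c 0 (a i) (by omega) (fun s _ h => hs s (by omega))
    simpa using this
  set d := (j : ℕ) - i with hd
  have I2 : ∀ e, t ≤ e → e ≤ L → (∀ s, t ≤ s → s ≤ e → (c 0).2 + j ≤ (c s).2) →
      Iter M.StepAny (e - a j) (c (a i)) ((c e).1, (c e).2 - d) := by
    intro e h1 h2 h3
    have hall : ∀ s, a j ≤ s → s ≤ e → (c 0).2 + j ≤ (c s).2 := by
      intro s h4 h5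
      rcases h4.lt_or_eq with h4 | h4
      · rcases le_total t s with h | h
        · exact h3 s h h5
        · exact (hgj s h4 h).le
      · rw [← h4, hvj]
    have := Iter.of_fun' (r := M.StepAny) (fun s => ((c s).1, (c s).2 - d)) (a j) e (by omega) (by
      intro s h4 h5
      have := hall s h4 (by omega)
      have := hall (s + 1) (by omega) (by omega)
      exact (hs s (by omega)).shift d (by omega) (by omega) (by omega))
    have heq : c (a i) = ((c (a j)).1, (c (a j)).2 - d) := by
      refine Prod.ext he1 ?_
      simp only
      omega
    rw [heq]
    exact this
  have hwi := hw i
  rw [he2] at hwi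
  rcases hw j with ⟨hn, hall⟩ | ⟨b, hb1, hb2, hb3, hb4, hb5⟩
  · have := I1.trans' (I2 L ht le_rfl (fun s h1 h2 => (hall s h1 h2).le))
    rw [hq] at this
    have := hmin _ _ this
    omega
  · rcases hwi with ⟨hn, _⟩ | ⟨b', hc1, hc2, hc3, hc4, hc5⟩
    · simp [hn] at hb3
    · have hst : (c b).1 = (c b').1 := by
        rw [hb3] at hc3
        exact Option.some.inj hc3
      have hbb : b < b' := by
        by_contra! h
        rcases h.lt_or_eq with h | h
        · have := hb5 b' hc1 h
          omega
        · rw [h] at hc4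
          omega
      have J := I2 b hb1 hb2 (fun s h1 h2 => by
        rcases h2.lt_or_eq with h2 | h2
        · exact (hb5 s h1 h2).le
        · rw [h2, hb4])
      have heq : ((c b).1, (c b).2 - d) = c b' := by
        refine Prod.ext hst ?_
        simp only
        omega
      rw [heq] at J
      have I3 := Iter.of_fun' (r := M.StepAny) c b' L hc2 (fun s _ h => hs s h)
      have := (I1.trans' J).trans' I3
      rw [show c L = (q, (c L).2) from Prod.ext hq rfl] at this
      have := hmin _ _ this
      omega

/-- Let `A` be a one-counter automaton with `K = |Q|` control states, `p, q ∈ Q`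
and `m ∈ ℕ`.  If `pm →* qn` for some `n`, then `pm →^k qn′` for some `n′` and some
`k ≤ max{m,1}·5K⁴`. -/
theorem oca_short_reachability {Q A : Type} [Fintype Q] [Fintype A] (M : OCA Q A)
    (p q : Q) (m : ℕ)
    (h : ∃ n : ℕ, Relation.ReflTransGen M.StepAny (p, m) (q, n)) :
    ∃ (n' k : ℕ), k ≤ max m 1 * (5 * Fintype.card Q ^ 4) ∧
      Iter M.StepAny k (p, m) (q, n') := by
  classical
  have hex : ∃ k n', Iter M.StepAny k (p, m) (q, n') := by
    obtain ⟨n, hn⟩ := h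
    obtain ⟨k, hk⟩ := Iter.of_reflTransGen hn
    exact ⟨k, n, hk⟩
  obtain ⟨n', hL⟩ := Nat.find_spec hex
  have hmin : ∀ k n, Iter M.StepAny k (p, m) (q, n) → Nat.find hex ≤ k :=
    fun k n hk => Nat.find_min' hex ⟨n, hk⟩
  generalize Nat.find hex = L at hL hmin
  refine ⟨n', L, ?_, hL⟩
  obtain ⟨c, hc0, hcL, hs⟩ := hL.exists_fun
  have hq : (c L).1 = q := by rw [hcL]
  rw [← hc0] at hmin
  have hh := oca_height M q L c hq hs hmin
  have hm : (c 0).2 = m := by rw [hc0]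
  rw [hm] at hh
  set K := Fintype.card Q with hK
  have hdist : ∀ i j, i < j → j ≤ L → c i ≠ c j := by
    intro i j hij hj he
    have I1 := Iter.of_fun' (r := M.StepAny) c 0 i (by omega) (fun s _ h => hs s (by omega))
    have I2 := Iter.of_fun' (r := M.StepAny) c j L hj (fun s _ h => hs s h)
    rw [← he, hcL] at I2
    have := hmin _ _ (I1.trans' I2)
    omega
  have hcard : L + 1 ≤ K * (m + K * (K + 1) + 1) := by
    have := Fintype.card_le_of_injective
      (fun i : Fin (L + 1) => (((c i).1, ⟨(c i).2, by
        have := hh i (by omega)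
        omega⟩) : Q × Fin (m + K * (K + 1) + 1))) (by
        intro i j hij
        obtain ⟨h1, h2⟩ := Prod.mk.inj hij
        have h2' : (c i).2 = (c j).2 := congrArg Fin.val h2
        have h3 : c i = c j := Prod.ext h1 h2'
        by_contra hne
        rcases lt_or_gt_of_ne hne with h | h
        · exact hdist i j h (by omega) h3
        · exact hdist j i h (by omega) h3.symm)
    simpa [Fintype.card_prod, ← hK] using this
  have hK1 : 1 ≤ K := Fintype.card_pos_iff.2 ⟨p⟩
  have hx1 : 1 ≤ max m 1 := le_max_right _ _
  have hx2 : m ≤ max m 1 := le_max_left _ _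
  generalize max m 1 = x at hx1 hx2 ⊢
  have p1 : K ≤ K ^ 4 := Nat.le_self_pow (by norm_num) K
  have p2 : K ^ 2 ≤ K ^ 4 := Nat.pow_le_pow_right hK1 (by norm_num)
  have p3 : K ^ 3 ≤ K ^ 4 := Nat.pow_le_pow_right hK1 (by norm_num)
  calc L ≤ K * (m + K * (K + 1) + 1) := by omega
    _ = m * K + (K ^ 3 + K ^ 2 + K) := by ring
    _ ≤ x * K ^ 4 + 1 * (K ^ 4 + K ^ 4 + K ^ 4) := by
      have := Nat.mul_le_mul hx2 p1
      omega
    _ ≤ x * K ^ 4 + x * (K ^ 4 + K ^ 4 + K ^ 4) := by gcongr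
    _ ≤ x * (5 * K ^ 4) := by
      have : 0 ≤ x * K ^ 4 := Nat.zero_le _
      nlinarith
end
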